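/- For smooth mean-zero f, g: 𝕋² → ℝ, the bilinear operator S[f,g] = Δ^{−1} div(𝒯[Δf] g + 𝒯[g] Δf), with 𝒯 = ∇^⊥Λ^{−1}, satisfies the identity S[f,g] = Σ_{i=1,2} 𝓡_i T[Λf, (𝓡^⊥)_i g], where T[u,v] = Λ^{−1}((Λu)v − u(Λv)), 𝓡_i is the Riesz transform with symbol i k_i/|k|, and (𝓡^⊥₁, 𝓡^⊥₂) = (−𝓡₂, 𝓡₁) are the components of ∇^⊥Λ^{−1}. -/

import Mathlib

/-!
Common setup: functions on the torus `𝕋^d = ℝ^d/(2πℤ)^d` are modelled as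
`2π`-periodic functions on `ℝ^d = Fin d → ℝ`, with Fourier coefficients,
Fourier multiplier operators, Hölder norms, etc.
-/

noncomputable section

open scoped BigOperators
open MeasureTheory

/-- Points of `ℝ^d` (covering the torus `𝕋^d = ℝ^d/(2πℤ)^d`). -/
abbrev Vd (d : ℕ) := Fin d → ℝ

/-- The lattice vector `2π m`. -/
def latt {d : ℕ} (m : Fin d → ℤ) : Vd d := fun i => 2 * Real.pi * (m i : ℝ)

/-- `f` is `2π`-periodic in each coordinate, i.e. a function on the torus `𝕋^d`. -/
def TorusFun {d : ℕ} {F : Type*} (f : Vd d → F) : Prop :=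
  ∀ (x : Vd d) (m : Fin d → ℤ), f (x + latt m) = f x

/-- Dot product of an integer frequency with a point of `ℝ^d`. -/
def dotZ {d : ℕ} (k : Fin d → ℤ) (x : Vd d) : ℝ := ∑ i, (k i : ℝ) * x i

/-- The Euclidean norm on `ℝ^d`. -/
def eNorm {d : ℕ} (x : Vd d) : ℝ := Real.sqrt (∑ i, (x i) ^ 2)

/-- `|k|` for an integer frequency `k ∈ ℤ^d`. -/
def kAbs {d : ℕ} (k : Fin d → ℤ) : ℝ := eNorm (fun i => (k i : ℝ))

/-- The fundamental domain `[0,2π]^d`. -/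
def box (d : ℕ) : Set (Vd d) := Set.Icc 0 (fun _ => 2 * Real.pi)

/-- Mean-zero (real-valued) function on the torus. -/
def MeanZeroR {d : ℕ} (f : Vd d → ℝ) : Prop := ∫ x in box d, f x = 0

/-- Fourier coefficient `f̂(k)` of a function on the torus. -/
def fCoeff {d : ℕ} (f : Vd d → ℂ) (k : Fin d → ℤ) : ℂ :=
  (((2 * Real.pi) ^ d)⁻¹ : ℝ) • ∫ x in box d, f x * Complex.exp (-(Complex.I * (dotZ k x : ℂ)))

/-- Fourier multiplier operator with symbol `m : ℤ^d → ℂ`. -/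
def fmul {d : ℕ} (m : (Fin d → ℤ) → ℂ) (f : Vd d → ℂ) : Vd d → ℂ :=
  fun x => ∑' k : Fin d → ℤ, m k * fCoeff f k * Complex.exp (Complex.I * (dotZ k x : ℂ))

/-- `Λ^s = (-Δ)^{s/2}`: Fourier multiplier with symbol `|k|^s` (acting on mean-zero parts). -/
def LamPow {d : ℕ} (s : ℝ) : (Vd d → ℂ) → Vd d → ℂ :=
  fmul (fun k => if k = 0 then 0 else (((kAbs k) ^ s : ℝ) : ℂ))

/-- `Λ = (-Δ)^{1/2}`. -/
def Lam1 {d : ℕ} : (Vd d → ℂ) → Vd d → ℂ := LamPow 1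

/-- `i`-th component of the SQG operator `∇^⊥Λ^{-1} = (-∂₂Λ^{-1}, ∂₁Λ^{-1})`,
with symbols `(-i k₂/|k|, i k₁/|k|)`. -/
def sqgOp (i : Fin 2) : (Vd 2 → ℂ) → Vd 2 → ℂ :=
  fmul (fun k => if k = 0 then 0 else
    (if i = 0 then -(Complex.I * (k 1 : ℂ)) else Complex.I * (k 0 : ℂ)) / ((kAbs k : ℝ) : ℂ))

/-- First-order partial derivative `∂_i`. -/
def pd {d : ℕ} {F : Type*} [NormedAddCommGroup F] [NormedSpace ℝ F]
    (i : Fin d) (f : Vd d → F) (x : Vd d) : F :=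
  fderiv ℝ f x (Pi.single i 1)

/-- Complexification of a real-valued function. -/
def cplx {d : ℕ} (f : Vd d → ℝ) : Vd d → ℂ := fun x => (f x : ℂ)

/-- The `C^N` norm: sum of sup-norms of the iterated derivatives of order `≤ N`. -/
def CkNorm {d : ℕ} {F : Type*} [NormedAddCommGroup F] [NormedSpace ℝ F]
    (N : ℕ) (f : Vd d → F) : ℝ :=
  ∑ n ∈ Finset.range (N + 1), ⨆ x : Vd d, ‖iteratedFDeriv ℝ n f x‖

/-- The `α`-Hölder seminorm. -/
def hSemi {d : ℕ} {F : Type*} [NormedAddCommGroup F] (α : ℝ) (f : Vd d → F) : ℝ :=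
  ⨆ p : Vd d × Vd d, if p.1 = p.2 then 0 else ‖f p.1 - f p.2‖ / ‖p.1 - p.2‖ ^ α

/-- The `C^{N,α}` Hölder norm `‖f‖_{N+α}`. -/
def HolNorm {d : ℕ} {F : Type*} [NormedAddCommGroup F] [NormedSpace ℝ F]
    (N : ℕ) (α : ℝ) (f : Vd d → F) : ℝ :=
  CkNorm N f + hSemi α (iteratedFDeriv ℝ N f)

/-- `∇^⊥·div R` for a `2`-tensor field `R` on `ℝ²` (values in any normed space). -/
def perpDivDiv {F : Type*} [NormedAddCommGroup F] [NormedSpace ℝ F]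
    (R : Vd 2 → Fin 2 → Fin 2 → F) (x : Vd 2) : F :=
  - pd 1 (fun y => ∑ j, pd j (fun z => R z 0 j) y) x
  + pd 0 (fun y => ∑ j, pd j (fun z => R z 1 j) y) x

/-- Material derivative `D_t f = ∂_t f + u·∇f`. -/
def matD (u : ℝ → Vd 2 → Fin 2 → ℝ) (f : ℝ → Vd 2 → ℝ) (t : ℝ) (x : Vd 2) : ℝ :=
  deriv (fun s => f s x) t + ∑ i, u t x i * pd i (f t) x

/-- The SQG–Reynolds system `∂_tθ + u·∇θ = ∇^⊥·div R`, `u = ∇^⊥Λ^{-1}θ`,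
for smooth space-periodic data with `R` symmetric. -/
structure SQGReynolds (θ : ℝ → Vd 2 → ℝ) (u : ℝ → Vd 2 → Fin 2 → ℝ)
    (R : ℝ → Vd 2 → Fin 2 → Fin 2 → ℝ) : Prop where
  smooth_θ : ContDiff ℝ (⊤ : ℕ∞) fun p : ℝ × Vd 2 => θ p.1 p.2
  smooth_u : ContDiff ℝ (⊤ : ℕ∞) fun p : ℝ × Vd 2 => u p.1 p.2
  smooth_R : ContDiff ℝ (⊤ : ℕ∞) fun p : ℝ × Vd 2 => R p.1 p.2
  periodic_θ : ∀ t, TorusFun (θ t)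
  periodic_u : ∀ t, TorusFun (u t)
  periodic_R : ∀ t, TorusFun (R t)
  symm_R : ∀ t x i j, R t x i j = R t x j i
  vel : ∀ t x i, (u t x i : ℂ) = sqgOp i (cplx (θ t)) x
  eqn : ∀ t x, matD u θ t x = perpDivDiv (R t) x

/-- The bilinear operator `T[f,g] = Λ^{-1}((Λf)g - f(Λg))`. -/
def Tbil (f g : Vd 2 → ℂ) : Vd 2 → ℂ :=
  LamPow (-1) (fun x => Lam1 f x * g x - f x * Lam1 g x)

/-- A Littlewood–Paley bump: smooth, spherically symmetric, `ψ = 1` on `B₁(0)`,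
`supp ψ ⊂ B_{3/2}(0)`. -/
structure LPfun {d : ℕ} (ψ : Vd d → ℝ) : Prop where
  smooth : ContDiff ℝ (⊤ : ℕ∞) ψ
  radial : ∀ x y : Vd d, eNorm x = eNorm y → ψ x = ψ y
  supp : ∀ x, 3/2 ≤ eNorm x → ψ x = 0
  one : ∀ x, eNorm x ≤ 1 → ψ x = 1

/-- Littlewood–Paley block `Δ_j f` (with `Δ_{-1}f = f̂(0)`, `Δ_j f = 0` for `j < -1`). -/
def LPblock {d : ℕ} (ψ : Vd d → ℝ) (j : ℤ) (f : Vd d → ℂ) : Vd d → ℂ :=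
  if j < -1 then 0
  else if j = -1 then fun _ => fCoeff f 0
  else fun x => ∑' k : Fin d → ℤ,
    (((ψ (fun i => (k i : ℝ) / 2 ^ j) - ψ (fun i => (k i : ℝ) / 2 ^ (j - 1))) : ℝ) : ℂ)
      * fCoeff f k * Complex.exp (Complex.I * (dotZ k x : ℂ))

/-- Low-frequency projection `S_j f = Σ_{i ≤ j} Δ_i f`. -/
def LPlow {d : ℕ} (ψ : Vd d → ℝ) (j : ℤ) (f : Vd d → ℂ) : Vd d → ℂ :=
  if j < -1 then 0
  else if j = -1 then fun _ => fCoeff f 0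
  else fun x => ∑' k : Fin d → ℤ,
    ((ψ (fun i => (k i : ℝ) / 2 ^ j) : ℝ) : ℂ)
      * fCoeff f k * Complex.exp (Complex.I * (dotZ k x : ℂ))

/-- Laplacian (computed from derivatives). -/
def lapC (f : Vd 2 → ℂ) (x : Vd 2) : ℂ := ∑ i, pd i (fun y => pd i f y) x

/-- Divergence of a vector field. -/
def divC (v : Vd 2 → Fin 2 → ℂ) (x : Vd 2) : ℂ := ∑ i, pd i (fun y => v y i) x

/-- Inverse Laplacian on mean-zero functions: symbol `-1/|k|²`. -/
def LapInv : (Vd 2 → ℂ) → Vd 2 → ℂ :=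
  fmul (fun k => if k = 0 then 0 else -((((kAbs k) ^ 2 : ℝ) : ℂ))⁻¹)

/-- `S[f,g] = Δ^{-1} div(𝒯[Δf] g + 𝒯[g] Δf)` with `𝒯 = ∇^⊥Λ^{-1}`. -/
def Sbil (f g : Vd 2 → ℂ) : Vd 2 → ℂ :=
  LapInv (fun x =>
    divC (fun y i => sqgOp i (fun z => lapC f z) y * g y + sqgOp i g y * lapC f y) x)

/-- The Riesz transform `𝓡_i`, with symbol `i k_i/|k|`. -/
def Riesz (i : Fin 2) : (Vd 2 → ℂ) → Vd 2 → ℂ :=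
  fmul (fun k => if k = 0 then 0 else Complex.I * (k i : ℂ) / ((kAbs k : ℝ) : ℂ))

/-- The character `x ↦ e^{i k·x}` of the torus. -/
def torusChar {d : ℕ} (k : Fin d → ℤ) (x : Vd d) : ℂ :=
  Complex.exp (Complex.I * (dotZ k x : ℂ))

/-- The trigonometric series with coefficients `a`. -/
def trigSeries {d : ℕ} (a : (Fin d → ℤ) → ℂ) (x : Vd d) : ℂ :=
  ∑' k, a k * torusChar k x

lemma dotZ_add {d : ℕ} (k l : Fin d → ℤ) (x : Vd d) : dotZ (k + l) x = dotZ k x + dotZ l x := by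
  simp [dotZ, add_mul, Finset.sum_add_distrib]

lemma dotZ_neg {d : ℕ} (k : Fin d → ℤ) (x : Vd d) : dotZ (-k) x = -dotZ k x := by
  simp [dotZ]

lemma torusChar_zero {d : ℕ} : torusChar (0 : Fin d → ℤ) = 1 := by
  ext x; simp [torusChar, dotZ]

lemma torusChar_add {d : ℕ} (k l : Fin d → ℤ) (x : Vd d) :
    torusChar (k + l) x = torusChar k x * torusChar l x := by
  simp [torusChar, dotZ_add, mul_add, Complex.exp_add]

lemma exp_neg_dotZ {d : ℕ} (k : Fin d → ℤ) (x : Vd d) :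
    Complex.exp (-(Complex.I * (dotZ k x : ℂ))) = torusChar (-k) x := by
  simp [torusChar, dotZ_neg]

lemma norm_torusChar {d : ℕ} (k : Fin d → ℤ) (x : Vd d) : ‖torusChar k x‖ = 1 := by
  rw [torusChar, mul_comm, Complex.norm_exp_ofReal_mul_I]

lemma torusFun_torusChar {d : ℕ} (k : Fin d → ℤ) : TorusFun (torusChar k) := by
  intro x m
  have h : dotZ k (x + latt m) = dotZ k x + ((∑ i, k i * m i : ℤ) : ℝ) * (2 * Real.pi) := by
    simp only [dotZ, latt, Pi.add_apply, mul_add, Finset.sum_add_distrib]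
    push_cast
    rw [Finset.sum_mul]
    congr 1
    exact Finset.sum_congr rfl fun i _ => by ring
  have h' : Complex.exp (Complex.I * ((((∑ i, k i * m i : ℤ) : ℝ) * (2 * Real.pi) : ℝ) : ℂ)) = 1 :=
    Complex.exp_eq_one_iff.2 ⟨∑ i, k i * m i, by push_cast; ring⟩
  rw [torusChar, torusChar, h, Complex.ofReal_add, mul_add, Complex.exp_add, h', mul_one]

/-- The linear functional `x ↦ k·x`. -/
def dotZCLM {d : ℕ} (k : Fin d → ℤ) : Vd d →L[ℝ] ℝ :=
  ∑ i, (k i : ℝ) • ContinuousLinearMap.proj i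

lemma dotZCLM_apply {d : ℕ} (k : Fin d → ℤ) (x : Vd d) : dotZCLM k x = dotZ k x := by
  simp [dotZCLM, dotZ]

lemma hasFDerivAt_torusChar {d : ℕ} (k : Fin d → ℤ) (x : Vd d) :
    HasFDerivAt (torusChar k)
      (torusChar k x • Complex.I • (Complex.ofRealCLM.comp (dotZCLM k))) x := by
  have h : HasFDerivAt (fun y : Vd d => Complex.I * (dotZ k y : ℂ))
      (Complex.I • (Complex.ofRealCLM.comp (dotZCLM k))) x := by
    have := ((Complex.ofRealCLM.comp (dotZCLM k)).hasFDerivAt (x := x)).const_mul Complex.I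
    simpa [dotZCLM_apply] using this
  exact h.cexp

lemma contDiff_torusChar {d : ℕ} (k : Fin d → ℤ) {n : WithTop ℕ∞} :
    ContDiff ℝ n (torusChar k) := by
  have h : ContDiff ℝ n (fun y : Vd d => Complex.I * (dotZ k y : ℂ)) := by
    have := contDiff_const (c := Complex.I).mul
      (Complex.ofRealCLM.comp (dotZCLM k)).contDiff (𝕜 := ℝ) (n := n)
    simpa [dotZCLM_apply] using this
  exact h.cexp

lemma continuous_torusChar {d : ℕ} (k : Fin d → ℤ) : Continuous (torusChar k) :=
  (contDiff_torusChar k (n := 0)).continuous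

lemma pd_torusChar {d : ℕ} (k : Fin d → ℤ) (i : Fin d) (x : Vd d) :
    pd i (torusChar k) x = Complex.I * (k i : ℂ) * torusChar k x := by
  rw [pd, (hasFDerivAt_torusChar k x).fderiv]
  have : dotZ k (Pi.single i 1) = k i := by simp [dotZ, Pi.single_apply]
  simp [dotZCLM_apply, this]
  ring

lemma TorusFun.mul {d : ℕ} {F G : Vd d → ℂ} (hF : TorusFun F) (hG : TorusFun G) :
    TorusFun (fun x => F x * G x) := fun x m => by simp only [hF x m, hG x m]

lemma TorusFun.add {d : ℕ} {F G : Vd d → ℂ} (hF : TorusFun F) (hG : TorusFun G) :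
    TorusFun (fun x => F x + G x) := fun x m => by simp only [hF x m, hG x m]

lemma TorusFun.sub {d : ℕ} {F G : Vd d → ℂ} (hF : TorusFun F) (hG : TorusFun G) :
    TorusFun (fun x => F x - G x) := fun x m => by simp only [hF x m, hG x m]

lemma TorusFun.pd {d : ℕ} {F : Vd d → ℂ} (hF : TorusFun F) (i : Fin d) : TorusFun (pd i F) := by
  intro x m
  have h : (fun y => F (y + latt m)) = F := funext fun y => hF y m
  rw [_root_.pd, _root_.pd, ← fderiv_comp_add_right, h]

lemma torusFun_trigSeries {d : ℕ} (a : (Fin d → ℤ) → ℂ) : TorusFun (trigSeries a) := fun x m => by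
  simp only [trigSeries, torusFun_torusChar _ x m]

lemma norm_fderiv_torusChar_le {d : ℕ} (k : Fin d → ℤ) (x : Vd d) :
    ‖fderiv ℝ (torusChar k) x‖ ≤ ∑ i, |(k i : ℝ)| := by
  rw [(hasFDerivAt_torusChar k x).fderiv, norm_smul, norm_torusChar, norm_smul, Complex.norm_I,
    one_mul, one_mul]
  refine ContinuousLinearMap.opNorm_le_bound _ (by positivity) fun v => ?_
  simp only [ContinuousLinearMap.comp_apply, dotZCLM_apply, Complex.ofRealCLM_apply,
    Complex.norm_real, dotZ]
  refine (norm_sum_le _ _).trans ?_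
  rw [Finset.sum_mul]
  refine Finset.sum_le_sum fun i _ => ?_
  rw [norm_mul, Real.norm_eq_abs]
  exact mul_le_mul_of_nonneg_left (norm_le_pi_norm v i) (abs_nonneg _)

lemma contDiff_trigSeries {d : ℕ} {a : (Fin d → ℤ) → ℂ} (ha : Summable fun k => ‖a k‖)
    (ha' : Summable fun k => (∑ i, |(k i : ℝ)|) * ‖a k‖) : ContDiff ℝ 1 (trigSeries a) := by
  refine contDiff_tsum (N := 1)
    (v := fun n k => if n = 0 then ‖a k‖ else (∑ i, |(k i : ℝ)|) * ‖a k‖)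
    (fun k => contDiff_const.mul (contDiff_torusChar k)) (fun n _ => ?_) (fun n k x hn => ?_)
  · by_cases h : n = 0 <;> simp [h, ha, ha']
  · have hn' : n ≤ 1 := by exact_mod_cast hn
    interval_cases n
    · simp [norm_torusChar]
    · rw [norm_iteratedFDeriv_one, fderiv_const_mul
        (hasFDerivAt_torusChar k x).differentiableAt, norm_smul, mul_comm]
      simpa using mul_le_mul_of_nonneg_right (norm_fderiv_torusChar_le k x) (norm_nonneg (a k))

lemma integrableOn_box {d : ℕ} {F : Vd d → ℂ} (hF : Continuous F) : IntegrableOn F (box d) :=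
  hF.continuousOn.integrableOn_compact isCompact_Icc

lemma integrableOn_mul_torusChar {d : ℕ} {F : Vd d → ℂ} (hF : Continuous F) (k : Fin d → ℤ) :
    IntegrableOn (fun x => F x * torusChar k x) (box d) :=
  integrableOn_box (hF.mul (continuous_torusChar k))

lemma volume_real_box (d : ℕ) : volume.real (box d) = (2 * Real.pi) ^ d := by
  simp [box, Measure.real, Real.volume_Icc_pi, Real.pi_pos.le]

/-- The derivative of a periodic function has integral zero over a period. -/
lemma integral_pd_eq_zero {d : ℕ} {F : Vd d → ℂ} (hF : ContDiff ℝ 1 F) (hp : TorusFun F)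
    (i : Fin d) : ∫ x in box d, pd i F x = 0 := by
  cases d with
  | zero => exact i.elim0
  | succ n =>
    have hc : Continuous (pd i F) := (hF.continuous_fderiv one_ne_zero).clm_apply continuous_const
    have hs : ∀ x, ∑ j, (if j = i then fderiv ℝ F x else 0) (Pi.single j 1) = pd i F x := by
      intro x
      rw [Finset.sum_eq_single i (fun j _ h => by simp [h]) (by simp)]
      simp [pd]
    have key := integral_divergence_of_hasFDerivAt_off_countable' (0 : Vd (n + 1))
      (fun _ => 2 * Real.pi) (fun _ => by positivity) (fun j => if j = i then F else 0)
      (fun j x => if j = i then fderiv ℝ F x else 0) ∅ Set.countable_empty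
      (fun j => by split_ifs <;> [exact hF.continuous.continuousOn; exact continuousOn_const])
      (fun x _ j => by
        split_ifs
        · exact (hF.differentiable one_ne_zero x).hasFDerivAt
        · exact hasFDerivAt_const 0 x)
      (by simp only [hs]; exact integrableOn_box hc)
    simp only [hs] at key
    rw [box, key]
    refine Finset.sum_eq_zero fun j _ => ?_
    rw [sub_eq_zero]
    refine integral_congr_ae (Filter.Eventually.of_forall fun x => ?_)
    by_cases h : j = i
    · subst h
      simp only [if_true]
      rw [← hp (j.insertNth ((0 : Vd (n + 1)) j) x) (Pi.single j 1)]
      congr 1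
      ext l
      rcases Fin.eq_self_or_eq_succAbove j l with rfl | ⟨l, rfl⟩ <;> simp [latt]
    · simp [h]

lemma pd_mul {d : ℕ} {F G : Vd d → ℂ} (hF : Differentiable ℝ F) (hG : Differentiable ℝ G)
    (i : Fin d) (x : Vd d) :
    pd i (fun y => F y * G y) x = F x * pd i G x + pd i F x * G x := by
  simp only [pd]
  rw [fderiv_fun_mul (hF x) (hG x)]
  simp [mul_comm]

lemma integral_torusChar {d : ℕ} (k : Fin d → ℤ) :
    ∫ x in box d, torusChar k x = if k = 0 then (((2 * Real.pi) ^ d : ℝ) : ℂ) else 0 := by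
  split_ifs with h
  · simp [h, torusChar_zero, volume_real_box]
  · obtain ⟨i, hi⟩ := Function.ne_iff.1 h
    have := integral_pd_eq_zero (contDiff_torusChar k) (torusFun_torusChar k) i
    simp only [pd_torusChar] at this
    rw [integral_const_mul] at this
    simpa [Complex.I_ne_zero, show k i ≠ 0 from hi] using this

lemma fCoeff_eq {d : ℕ} (F : Vd d → ℂ) (k : Fin d → ℤ) :
    fCoeff F k = (((2 * Real.pi) ^ d)⁻¹ : ℝ) • ∫ x in box d, F x * torusChar (-k) x := by
  simp only [fCoeff, exp_neg_dotZ]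

lemma fCoeff_one {d : ℕ} (k : Fin d → ℤ) :
    fCoeff (fun _ => (1 : ℂ)) k = if k = 0 then 1 else 0 := by
  have h : ((2 * Real.pi) ^ d : ℝ) ≠ 0 := by positivity
  simp only [fCoeff_eq, one_mul, integral_torusChar, neg_eq_zero]
  split_ifs
  · rw [Complex.real_smul, ← Complex.ofReal_mul, inv_mul_cancel₀ h, Complex.ofReal_one]
  · simp

lemma fCoeff_add {d : ℕ} {F G : Vd d → ℂ} (hF : Continuous F) (hG : Continuous G)
    (k : Fin d → ℤ) : fCoeff (fun x => F x + G x) k = fCoeff F k + fCoeff G k := by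
  simp only [fCoeff_eq, add_mul]
  rw [integral_add (integrableOn_mul_torusChar hF _)
    (integrableOn_mul_torusChar hG _), smul_add]

lemma fCoeff_sub {d : ℕ} {F G : Vd d → ℂ} (hF : Continuous F) (hG : Continuous G)
    (k : Fin d → ℤ) : fCoeff (fun x => F x - G x) k = fCoeff F k - fCoeff G k := by
  simp only [fCoeff_eq, sub_mul]
  rw [integral_sub (integrableOn_mul_torusChar hF _)
    (integrableOn_mul_torusChar hG _), smul_sub]

lemma fCoeff_pd {d : ℕ} {F : Vd d → ℂ} (hF : ContDiff ℝ 1 F) (hp : TorusFun F) (i : Fin d)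
    (k : Fin d → ℤ) : fCoeff (pd i F) k = Complex.I * (k i : ℂ) * fCoeff F k := by
  have hc : Continuous (pd i F) := (hF.continuous_fderiv one_ne_zero).clm_apply continuous_const
  have h0 := integral_pd_eq_zero (hF.mul (contDiff_torusChar (-k)))
    (hp.mul (torusFun_torusChar (-k))) i
  simp only [pd_mul (hF.differentiable one_ne_zero)
    ((contDiff_torusChar (-k) (n := 1)).differentiable one_ne_zero), pd_torusChar] at h0
  simp only [mul_left_comm (F _)] at h0
  rw [integral_add ((integrableOn_mul_torusChar hF.continuous _).const_mul _)
    (integrableOn_mul_torusChar hc _), integral_const_mul] at h0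
  rw [fCoeff_eq, fCoeff_eq, eq_neg_of_add_eq_zero_right h0]
  simp [Complex.real_smul]
  ring

lemma norm_fCoeff_le {d : ℕ} (F : Vd d → ℂ) (k : Fin d → ℤ) :
    ‖fCoeff F k‖ ≤ ((2 * Real.pi) ^ d)⁻¹ * ∫ x in box d, ‖F x‖ := by
  rw [fCoeff_eq, norm_smul, Real.norm_of_nonneg (by positivity)]
  refine mul_le_mul_of_nonneg_left ((norm_integral_le_integral_norm _).trans_eq ?_) (by positivity)
  simp [norm_torusChar]

lemma fCoeff_mul_torusChar {d : ℕ} (G : Vd d → ℂ) (k n : Fin d → ℤ) :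
    fCoeff (fun x => torusChar k x * G x) n = fCoeff G (n - k) := by
  simp only [fCoeff_eq]
  congr 2
  ext x
  rw [neg_sub, sub_eq_add_neg, torusChar_add]
  ring

/-- Fourier coefficients of the product of an absolutely convergent trigonometric series with a
continuous function. -/
lemma fCoeff_trigSeries_mul {d : ℕ} {a : (Fin d → ℤ) → ℂ} (ha : Summable fun k => ‖a k‖)
    {G : Vd d → ℂ} (hG : Continuous G) (n : Fin d → ℤ) :
    fCoeff (fun x => trigSeries a x * G x) n = ∑' k, a k * fCoeff G (n - k) := by
  simp only [← fCoeff_mul_torusChar]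
  simp only [fCoeff_eq, trigSeries, Complex.real_smul]
  simp only [mul_left_comm (a _)]
  rw [tsum_mul_left]
  congr 1
  simp only [← integral_const_mul, ← tsum_mul_right]
  rw [← integral_tsum_of_summable_integral_norm]
  · simp only [mul_assoc]
  · exact fun k => integrableOn_mul_torusChar
      ((continuous_const.mul (continuous_torusChar k)).mul hG) _
  · simp only [norm_mul, norm_torusChar, mul_one, integral_const_mul]
    exact ha.mul_right _

lemma fCoeff_trigSeries {d : ℕ} {a : (Fin d → ℤ) → ℂ} (ha : Summable fun k => ‖a k‖)
    (n : Fin d → ℤ) : fCoeff (trigSeries a) n = a n := by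
  have := fCoeff_trigSeries_mul ha (continuous_const (y := (1 : ℂ))) n
  simp only [mul_one, fCoeff_one, sub_eq_zero] at this
  rw [show trigSeries a = fun x => trigSeries a x from rfl, this, tsum_eq_single n]
  · simp
  · intro k hk
    simp [hk.symm]

/-- The weight `∏ i, (1 + k i ^ 2)` measuring the decay of Fourier coefficients. -/
def freqWeight {d : ℕ} (k : Fin d → ℤ) : ℝ := ∏ i, (1 + (k i : ℝ) ^ 2)

lemma one_add_sum_sq_le_freqWeight {d : ℕ} (k : Fin d → ℤ) :
    1 + ∑ i, (k i : ℝ) ^ 2 ≤ freqWeight k := by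
  rw [freqWeight]
  induction (Finset.univ : Finset (Fin d)) using Finset.induction_on with
  | empty => simp
  | insert i s hi ih =>
    rw [Finset.sum_insert hi, Finset.prod_insert hi]
    have : 0 ≤ ∑ j ∈ s, (k j : ℝ) ^ 2 := Finset.sum_nonneg fun _ _ => sq_nonneg _
    nlinarith [sq_nonneg (k i : ℝ)]

lemma sum_sq_le_freqWeight {d : ℕ} (k : Fin d → ℤ) : ∑ i, (k i : ℝ) ^ 2 ≤ freqWeight k := by
  linarith [one_add_sum_sq_le_freqWeight k]

lemma one_le_freqWeight {d : ℕ} (k : Fin d → ℤ) : 1 ≤ freqWeight k := by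
  have : 0 ≤ ∑ i, (k i : ℝ) ^ 2 := Finset.sum_nonneg fun _ _ => sq_nonneg _
  linarith [one_add_sum_sq_le_freqWeight k]

lemma freqWeight_pos {d : ℕ} (k : Fin d → ℤ) : 0 < freqWeight k :=
  zero_lt_one.trans_le (one_le_freqWeight k)

lemma abs_le_freqWeight {d : ℕ} (k : Fin d → ℤ) (i : Fin d) : |(k i : ℝ)| ≤ freqWeight k := by
  have h1 : |(k i : ℝ)| ≤ (k i : ℝ) ^ 2 := by
    rw [← sq_abs]
    rcases eq_or_ne (k i) 0 with h | h
    · simp [h]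
    · have : (1 : ℝ) ≤ |(k i : ℝ)| := by exact_mod_cast Int.one_le_abs h
      nlinarith
  exact h1.trans ((Finset.single_le_sum (f := fun j => (k j : ℝ) ^ 2)
    (fun _ _ => sq_nonneg _) (Finset.mem_univ i)).trans (sum_sq_le_freqWeight k))

lemma kAbs_sq {d : ℕ} (k : Fin d → ℤ) : kAbs k ^ 2 = ∑ i, (k i : ℝ) ^ 2 :=
  Real.sq_sqrt (Finset.sum_nonneg fun _ _ => sq_nonneg _)

lemma kAbs_nonneg {d : ℕ} (k : Fin d → ℤ) : 0 ≤ kAbs k := Real.sqrt_nonneg _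

lemma abs_le_kAbs {d : ℕ} (k : Fin d → ℤ) (i : Fin d) : |(k i : ℝ)| ≤ kAbs k :=
  Real.abs_le_sqrt (Finset.single_le_sum (f := fun j => (k j : ℝ) ^ 2)
    (fun _ _ => sq_nonneg _) (Finset.mem_univ i))

lemma one_le_kAbs {d : ℕ} {k : Fin d → ℤ} (hk : k ≠ 0) : 1 ≤ kAbs k := by
  obtain ⟨i, hi⟩ := Function.ne_iff.1 hk
  exact le_trans (by exact_mod_cast Int.one_le_abs hi) (abs_le_kAbs k i)

lemma kAbs_le_freqWeight {d : ℕ} (k : Fin d → ℤ) : kAbs k ≤ freqWeight k := by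
  have := (kAbs_sq k).trans_le (sum_sq_le_freqWeight k)
  nlinarith [one_le_freqWeight k, kAbs_nonneg k]

lemma summable_inv_one_add_int_sq : Summable fun n : ℤ => (1 + (n : ℝ) ^ 2)⁻¹ := by
  refine Summable.of_norm_bounded_eventually
    (Real.summable_one_div_int_pow.2 one_lt_two) ?_
  filter_upwards [(Set.finite_singleton (0 : ℤ)).compl_mem_cofinite] with n hn
  have hn' : (n : ℝ) ≠ 0 := by exact_mod_cast hn
  rw [Real.norm_of_nonneg (by positivity), one_div]
  exact inv_anti₀ (by positivity) (by linarith)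

lemma summable_inv_freqWeight : Summable fun k : Fin 2 → ℤ => (freqWeight k)⁻¹ := by
  rw [← (finTwoArrowEquiv ℤ).symm.summable_iff]
  refine (summable_inv_one_add_int_sq.mul_of_nonneg summable_inv_one_add_int_sq
    (fun n => by positivity) fun n => by positivity).congr fun p => ?_
  simp [freqWeight, mul_comm]

/-- Coefficients decaying faster than any power of the frequency. -/
def RapidDecay {d : ℕ} (a : (Fin d → ℤ) → ℂ) : Prop :=
  ∀ N : ℕ, Summable fun k => freqWeight k ^ N * ‖a k‖

lemma RapidDecay.summable {d : ℕ} {a : (Fin d → ℤ) → ℂ} (ha : RapidDecay a) :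
    Summable fun k => ‖a k‖ := by simpa using ha 0

lemma RapidDecay.mul {d : ℕ} {a m : (Fin d → ℤ) → ℂ} (ha : RapidDecay a)
    (hm : ∀ k, ‖m k‖ ≤ freqWeight k) : RapidDecay fun k => m k * a k := fun N => by
  refine Summable.of_nonneg_of_le (fun k => ?_) (fun k => ?_) (ha (N + 1))
  · have := freqWeight_pos k
    positivity
  · have := freqWeight_pos k
    rw [norm_mul, pow_succ, mul_assoc]
    gcongr
    exact hm k

lemma RapidDecay.contDiff_trigSeries {d : ℕ} {a : (Fin d → ℤ) → ℂ} (ha : RapidDecay a) :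
    ContDiff ℝ 1 (trigSeries a) := by
  refine _root_.contDiff_trigSeries ha.summable
    (Summable.of_nonneg_of_le (fun k => by positivity) (fun k => ?_) ((ha 1).mul_left (d : ℝ)))
  rw [pow_one, ← mul_assoc]
  gcongr
  simpa using Finset.sum_le_card_nsmul Finset.univ _ _ fun i _ => abs_le_freqWeight k i

lemma contDiff_pd {d : ℕ} {F : Vd d → ℂ} (hF : ContDiff ℝ (⊤ : ℕ∞) F) (i : Fin d) :
    ContDiff ℝ (⊤ : ℕ∞) (pd i F) :=
  (hF.fderiv_right (m := (⊤ : ℕ∞)) (by norm_cast)).clm_apply contDiff_const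

lemma fCoeff_sub_pd_pd {d : ℕ} {F : Vd d → ℂ} (hF : ContDiff ℝ (⊤ : ℕ∞) F) (hp : TorusFun F)
    (i : Fin d) (k : Fin d → ℤ) :
    fCoeff (fun x => F x - pd i (pd i F) x) k = ((1 + (k i : ℝ) ^ 2 : ℝ) : ℂ) * fCoeff F k := by
  have h1 : (1 : WithTop ℕ∞) ≤ ((⊤ : ℕ∞) : WithTop ℕ∞) := by exact_mod_cast le_top
  rw [fCoeff_sub hF.continuous (contDiff_pd (contDiff_pd hF i) i).continuous,
    fCoeff_pd ((contDiff_pd hF i).of_le h1) (hp.pd i), fCoeff_pd (hF.of_le h1) hp]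
  push_cast
  linear_combination (-(k i : ℂ) ^ 2 * fCoeff F k) * Complex.I_sq

lemma exists_freqWeight_pow_mul_norm_fCoeff_le (p : ℕ) :
    ∀ {F : Vd 2 → ℂ}, ContDiff ℝ (⊤ : ℕ∞) F → TorusFun F →
      ∃ C, ∀ k, freqWeight k ^ p * ‖fCoeff F k‖ ≤ C := by
  induction p with
  | zero => exact fun {F} _ _ => ⟨_, fun k => by simpa using norm_fCoeff_le F k⟩
  | succ p ih =>
    intro F hF hp
    have hF' := hF.sub (contDiff_pd (contDiff_pd hF 0) 0)
    have hp' := hp.sub ((hp.pd 0).pd 0)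
    obtain ⟨C, hC⟩ := ih (hF'.sub (contDiff_pd (contDiff_pd hF' 1) 1))
      (hp'.sub ((hp'.pd 1).pd 1))
    refine ⟨C, fun k => (Eq.le ?_).trans (hC k)⟩
    have hk := (fCoeff_sub_pd_pd hF' hp' 1 k).trans
      (congrArg _ (fCoeff_sub_pd_pd hF hp 0 k))
    refine Eq.trans ?_ (congrArg (fun z => freqWeight k ^ p * ‖z‖) hk).symm
    have h0 : (0 : ℝ) ≤ 1 + (k 0 : ℝ) ^ 2 := by positivity
    have h1 : (0 : ℝ) ≤ 1 + (k 1 : ℝ) ^ 2 := by positivity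
    rw [norm_mul, norm_mul, Complex.norm_real, Complex.norm_real, Real.norm_of_nonneg h0,
      Real.norm_of_nonneg h1, pow_succ]
    nth_rw 2 [freqWeight]
    rw [Fin.prod_univ_two]
    ring

lemma rapidDecay_fCoeff {F : Vd 2 → ℂ} (hF : ContDiff ℝ (⊤ : ℕ∞) F) (hp : TorusFun F) :
    RapidDecay (fCoeff F) := fun N => by
  obtain ⟨C, hC⟩ := exists_freqWeight_pow_mul_norm_fCoeff_le (N + 1) hF hp
  refine Summable.of_nonneg_of_le (fun k => ?_) (fun k => ?_) (summable_inv_freqWeight.mul_left C)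
  · have := freqWeight_pos k
    positivity
  · rw [← div_eq_mul_inv, le_div_iff₀ (freqWeight_pos k)]
    refine (Eq.le ?_).trans (hC k)
    ring

/-- Discrete convolution. -/
def freqConv {d : ℕ} (u v : (Fin d → ℤ) → ℂ) (n : Fin d → ℤ) : ℂ := ∑' k, u k * v (n - k)

lemma summable_mul_comp_sub {d : ℕ} {u v : (Fin d → ℤ) → ℂ} (hu : Summable fun k => ‖u k‖)
    (hv : Summable fun k => ‖v k‖) :
    Summable fun p : (Fin d → ℤ) × (Fin d → ℤ) => ‖u p.2 * v (p.1 - p.2)‖ := by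
  have hinj : Function.Injective
      fun p : (Fin d → ℤ) × (Fin d → ℤ) => (p.2, p.1 - p.2) := by
    rintro ⟨n, k⟩ ⟨n', k'⟩ h
    simp only [Prod.mk.injEq] at h
    obtain ⟨rfl, h⟩ := h
    simpa using h
  have h := (hu.mul_of_nonneg hv (fun _ => norm_nonneg _)
    fun _ => norm_nonneg _).comp_injective hinj
  exact h.congr fun p => (norm_mul _ _).symm

lemma hasSum_freqConv {d : ℕ} {u v : (Fin d → ℤ) → ℂ} (hu : Summable fun k => ‖u k‖)
    (hv : Summable fun k => ‖v k‖) (n : Fin d → ℤ) :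
    HasSum (fun k => u k * v (n - k)) (freqConv u v n) :=
  ((summable_mul_comp_sub hu hv).prod_factor n).of_norm.hasSum

lemma summable_norm_freqConv {d : ℕ} {u v : (Fin d → ℤ) → ℂ} (hu : Summable fun k => ‖u k‖)
    (hv : Summable fun k => ‖v k‖) : Summable fun n => ‖freqConv u v n‖ :=
  Summable.of_nonneg_of_le (fun _ => norm_nonneg _)
    (fun n => norm_tsum_le_tsum_norm ((summable_mul_comp_sub hu hv).prod_factor n))
    (summable_mul_comp_sub hu hv).prod

lemma freqConv_comm {d : ℕ} (u v : (Fin d → ℤ) → ℂ) : freqConv u v = freqConv v u := by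
  ext n
  rw [freqConv, ← (Equiv.subLeft n).tsum_eq]
  simp [freqConv, mul_comm]

lemma trigSeries_add {d : ℕ} {a b : (Fin d → ℤ) → ℂ} (ha : Summable fun k => ‖a k‖)
    (hb : Summable fun k => ‖b k‖) (x : Vd d) :
    trigSeries (fun k => a k + b k) x = trigSeries a x + trigSeries b x := by
  have h : ∀ {c : (Fin d → ℤ) → ℂ}, (Summable fun k => ‖c k‖) →
      Summable fun k => c k * torusChar k x := fun hc =>
    Summable.of_norm (by simpa [norm_torusChar] using hc)
  simp only [trigSeries, add_mul]
  exact (h ha).tsum_add (h hb)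

lemma contDiff_lapC {F : Vd 2 → ℂ} (hF : ContDiff ℝ (⊤ : ℕ∞) F) :
    ContDiff ℝ (⊤ : ℕ∞) (lapC F) :=
  ContDiff.sum fun i _ => contDiff_pd (contDiff_pd hF i) i

lemma TorusFun.lapC {F : Vd 2 → ℂ} (hp : TorusFun F) : TorusFun (lapC F) := fun x m =>
  Finset.sum_congr rfl fun i _ => (hp.pd i).pd i x m

lemma fCoeff_lapC {F : Vd 2 → ℂ} (hF : ContDiff ℝ (⊤ : ℕ∞) F) (hp : TorusFun F)
    (k : Fin 2 → ℤ) : fCoeff (lapC F) k = -((kAbs k ^ 2 : ℝ) : ℂ) * fCoeff F k := by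
  have h1 : (1 : WithTop ℕ∞) ≤ ((⊤ : ℕ∞) : WithTop ℕ∞) := by exact_mod_cast le_top
  have h : lapC F = fun x => pd 0 (pd 0 F) x + pd 1 (pd 1 F) x :=
    funext fun x => Fin.sum_univ_two _
  rw [h, fCoeff_add (contDiff_pd (contDiff_pd hF 0) 0).continuous
      (contDiff_pd (contDiff_pd hF 1) 1).continuous,
    fCoeff_pd ((contDiff_pd hF 0).of_le h1) (hp.pd 0), fCoeff_pd (hF.of_le h1) hp,
    fCoeff_pd ((contDiff_pd hF 1).of_le h1) (hp.pd 1), fCoeff_pd (hF.of_le h1) hp,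
    kAbs_sq, Fin.sum_univ_two]
  push_cast
  linear_combination ((k 0 : ℂ) ^ 2 + (k 1 : ℂ) ^ 2) * fCoeff F k * Complex.I_sq

lemma fCoeff_divC {V : Vd 2 → Fin 2 → ℂ} (hV : ∀ i, ContDiff ℝ 1 fun y => V y i)
    (hp : ∀ i, TorusFun fun y => V y i) (k : Fin 2 → ℤ) :
    fCoeff (divC V) k = Complex.I * (k 0 : ℂ) * fCoeff (fun y => V y 0) k +
      Complex.I * (k 1 : ℂ) * fCoeff (fun y => V y 1) k := by
  have hc : ∀ i, Continuous (pd i fun y => V y i) := fun i =>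
    ((hV i).continuous_fderiv one_ne_zero).clm_apply continuous_const
  have h : divC V = fun x => pd 0 (fun y => V y 0) x + pd 1 (fun y => V y 1) x :=
    funext fun x => Fin.sum_univ_two _
  rw [h, fCoeff_add (hc 0) (hc 1), fCoeff_pd (hV 0) (hp 0), fCoeff_pd (hV 1) (hp 1)]

/-- The symbol of `sqgOp i`. -/
def sqgSymbol (i : Fin 2) (k : Fin 2 → ℤ) : ℂ :=
  if k = 0 then 0 else
    (if i = 0 then -(Complex.I * (k 1 : ℂ)) else Complex.I * (k 0 : ℂ)) / ((kAbs k : ℝ) : ℂ)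

/-- The symbol of `LamPow s`. -/
def lamSymbol {d : ℕ} (s : ℝ) (k : Fin d → ℤ) : ℂ :=
  if k = 0 then 0 else (((kAbs k) ^ s : ℝ) : ℂ)

/-- The symbol of `Riesz i`. -/
def rieszSymbol (i : Fin 2) (k : Fin 2 → ℤ) : ℂ :=
  if k = 0 then 0 else Complex.I * (k i : ℂ) / ((kAbs k : ℝ) : ℂ)

/-- The symbol of `LapInv`. -/
def lapInvSymbol (k : Fin 2 → ℤ) : ℂ :=
  if k = 0 then 0 else -((((kAbs k) ^ 2 : ℝ) : ℂ))⁻¹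

lemma lamPow_eq {d : ℕ} (s : ℝ) (F : Vd d → ℂ) :
    LamPow s F = trigSeries fun k => lamSymbol s k * fCoeff F k := rfl

lemma lam1_eq {d : ℕ} (F : Vd d → ℂ) :
    Lam1 F = trigSeries fun k => lamSymbol 1 k * fCoeff F k := rfl

lemma riesz_eq (i : Fin 2) (F : Vd 2 → ℂ) :
    Riesz i F = trigSeries fun k => rieszSymbol i k * fCoeff F k := rfl

lemma lapInv_eq (F : Vd 2 → ℂ) :
    LapInv F = trigSeries fun k => lapInvSymbol k * fCoeff F k := rfl

lemma norm_I_mul_div_kAbs_le_one {d : ℕ} (k : Fin d → ℤ) (i : Fin d) :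
    ‖Complex.I * (k i : ℂ) / ((kAbs k : ℝ) : ℂ)‖ ≤ 1 := by
  rw [norm_div, norm_mul, Complex.norm_I, one_mul, Complex.norm_real, Complex.norm_intCast,
    Real.norm_of_nonneg (kAbs_nonneg k)]
  exact div_le_one_of_le₀ (abs_le_kAbs k i) (kAbs_nonneg k)

lemma norm_rieszSymbol_le_one (i : Fin 2) (k : Fin 2 → ℤ) : ‖rieszSymbol i k‖ ≤ 1 := by
  rw [rieszSymbol]
  split_ifs
  · simp
  · exact norm_I_mul_div_kAbs_le_one k i

lemma norm_sqgSymbol_le_one (i : Fin 2) (k : Fin 2 → ℤ) : ‖sqgSymbol i k‖ ≤ 1 := by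
  rw [sqgSymbol]
  split_ifs
  · simp
  · rw [neg_div, norm_neg]
    exact norm_I_mul_div_kAbs_le_one k 1
  · exact norm_I_mul_div_kAbs_le_one k 0

lemma norm_lamSymbol_one_le {d : ℕ} (k : Fin d → ℤ) : ‖lamSymbol 1 k‖ ≤ freqWeight k := by
  rw [lamSymbol]
  split_ifs
  · simpa using (freqWeight_pos k).le
  · rw [Real.rpow_one, Complex.norm_real, Real.norm_of_nonneg (kAbs_nonneg k)]
    exact kAbs_le_freqWeight k

lemma norm_lamSymbol_neg_one_le_one {d : ℕ} (k : Fin d → ℤ) : ‖lamSymbol (-1) k‖ ≤ 1 := by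
  rw [lamSymbol]
  split_ifs with h
  · simp
  · rw [Complex.norm_real, Real.norm_of_nonneg (Real.rpow_nonneg (kAbs_nonneg k) _)]
    exact Real.rpow_le_one_of_one_le_of_nonpos (one_le_kAbs h) (by norm_num)

lemma summable_norm_mul_of_le_one {d : ℕ} {m a : (Fin d → ℤ) → ℂ} (hm : ∀ k, ‖m k‖ ≤ 1)
    (ha : Summable fun k => ‖a k‖) : Summable fun k => ‖m k * a k‖ :=
  Summable.of_nonneg_of_le (fun _ => norm_nonneg _)
    (fun k => by rw [norm_mul]; exact mul_le_of_le_one_left (norm_nonneg _) (hm k)) ha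

lemma RapidDecay.sqg {a : (Fin 2 → ℤ) → ℂ} (ha : RapidDecay a) (i : Fin 2) :
    RapidDecay fun k => sqgSymbol i k * a k :=
  ha.mul fun k => (norm_sqgSymbol_le_one i k).trans (one_le_freqWeight k)

lemma RapidDecay.lam {d : ℕ} {a : (Fin d → ℤ) → ℂ} (ha : RapidDecay a) :
    RapidDecay fun k => lamSymbol 1 k * a k :=
  ha.mul norm_lamSymbol_one_le

/-- The identity between the bilinear symbols of the two sides, for input frequencies `k` and `l`
and output frequency `k + l`. -/
lemma bilinear_symbol_identity {k l : Fin 2 → ℤ} (hk : k ≠ 0) (hl : l ≠ 0) (hn : k + l ≠ 0) :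
    lapInvSymbol (k + l) * -((kAbs k ^ 2 : ℝ) : ℂ) *
        (Complex.I * ((k + l) 0 : ℤ) * (sqgSymbol 0 k + sqgSymbol 0 l) +
          Complex.I * ((k + l) 1 : ℤ) * (sqgSymbol 1 k + sqgSymbol 1 l)) =
      lamSymbol (-1) (k + l) * lamSymbol 1 k * (lamSymbol 1 k - lamSymbol 1 l) *
        (rieszSymbol 0 (k + l) * sqgSymbol 0 l + rieszSymbol 1 (k + l) * sqgSymbol 1 l) := by
  have h : ∀ {m : Fin 2 → ℤ}, m ≠ 0 → (kAbs m : ℂ) ≠ 0 := fun hm =>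
    Complex.ofReal_ne_zero.2 (zero_lt_one.trans_le (one_le_kAbs hm)).ne'
  have hk' := h hk
  have hl' := h hl
  have hn' := h hn
  simp only [lapInvSymbol, sqgSymbol, lamSymbol, rieszSymbol, hk, hl, hn, if_false, if_true,
    Real.rpow_one, Real.rpow_neg_one, one_ne_zero, Pi.add_apply]
  push_cast
  field_simp
  ring

theorem bilinear_identity_of_contDiff {f g : Vd 2 → ℂ}
    (hf : ContDiff ℝ (⊤ : ℕ∞) f) (hg : ContDiff ℝ (⊤ : ℕ∞) g)
    (hfp : TorusFun f) (hgp : TorusFun g) (hf0 : fCoeff f 0 = 0) (hg0 : fCoeff g 0 = 0)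
    (x : Vd 2) :
    Sbil f g x = ∑ i, Riesz i (Tbil (Lam1 f) (fun y => sqgOp i g y)) x := by
  have h1 : (1 : WithTop ℕ∞) ≤ ((⊤ : ℕ∞) : WithTop ℕ∞) := by exact_mod_cast le_top
  have ha := rapidDecay_fCoeff hf hfp
  have hb := rapidDecay_fCoeff hg hgp
  have hq := rapidDecay_fCoeff (contDiff_lapC hf) hfp.lapC
  have hS : ∀ i n, fCoeff (fun y => sqgOp i (fun z => lapC f z) y * g y +
      sqgOp i g y * lapC f y) n =
      freqConv (fun k => sqgSymbol i k * fCoeff (lapC f) k) (fCoeff g) n +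
        freqConv (fCoeff (lapC f)) (fun k => sqgSymbol i k * fCoeff g k) n := by
    intro i n
    refine (fCoeff_add ((hq.sqg i).contDiff_trigSeries.continuous.mul hg.continuous)
      ((hb.sqg i).contDiff_trigSeries.continuous.mul (contDiff_lapC hf).continuous) n).trans ?_
    rw [freqConv_comm (fCoeff (lapC f))]
    exact congrArg₂ _ (fCoeff_trigSeries_mul (hq.sqg i).summable hg.continuous n)
      (fCoeff_trigSeries_mul (hb.sqg i).summable (contDiff_lapC hf).continuous n)
  have hL : ∀ n, fCoeff (Lam1 f) n = lamSymbol 1 n * fCoeff f n :=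
    fCoeff_trigSeries ha.lam.summable
  have hs : ∀ i n, fCoeff (sqgOp i g) n = sqgSymbol i n * fCoeff g n := fun i =>
    fCoeff_trigSeries (hb.sqg i).summable
  let A : Fin 2 → (Fin 2 → ℤ) → ℂ := fun i =>
    freqConv (fun k => lamSymbol 1 k * (lamSymbol 1 k * fCoeff f k))
      (fun k => sqgSymbol i k * fCoeff g k)
  let B : Fin 2 → (Fin 2 → ℤ) → ℂ := fun i =>
    freqConv (fun k => lamSymbol 1 k * fCoeff f k)
      (fun k => lamSymbol 1 k * (sqgSymbol i k * fCoeff g k))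
  have hAB : ∀ i, Summable fun n => ‖A i n - B i n‖ := fun i =>
    Summable.of_nonneg_of_le (fun _ => norm_nonneg _) (fun n => norm_sub_le _ _)
      ((summable_norm_freqConv ha.lam.lam.summable (hb.sqg i).summable).add
        (summable_norm_freqConv ha.lam.summable (hb.sqg i).lam.summable))
  have hH : ∀ i n, fCoeff (fun y => Lam1 (Lam1 f) y * sqgOp i g y -
      Lam1 f y * Lam1 (sqgOp i g) y) n = A i n - B i n := by
    intro i n
    have e1 : Lam1 (Lam1 f) = trigSeries fun k => lamSymbol 1 k * (lamSymbol 1 k * fCoeff f k) := by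
      rw [lam1_eq]; simp only [hL]
    have e2 : Lam1 (sqgOp i g) =
        trigSeries fun k => lamSymbol 1 k * (sqgSymbol i k * fCoeff g k) := by
      rw [lam1_eq]; simp only [hs]
    have c1 : Continuous (sqgOp i g) := (hb.sqg i).contDiff_trigSeries.continuous
    have c2 := (hb.sqg i).lam.contDiff_trigSeries.continuous
    rw [e1, e2, lam1_eq, fCoeff_sub (ha.lam.lam.contDiff_trigSeries.continuous.fun_mul c1)
      (ha.lam.contDiff_trigSeries.continuous.fun_mul c2),
      fCoeff_trigSeries_mul ha.lam.lam.summable c1, fCoeff_trigSeries_mul ha.lam.summable c2]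
    simp only [hs, fCoeff_trigSeries (hb.sqg i).lam.summable]
    rfl
  have hT : ∀ i n, fCoeff (Tbil (Lam1 f) (fun y => sqgOp i g y)) n =
      lamSymbol (-1) n * (A i n - B i n) := by
    intro i n
    rw [Tbil, lamPow_eq]
    have e : (fun k => lamSymbol (-1) k * fCoeff (fun y => Lam1 (Lam1 f) y * sqgOp i g y -
        Lam1 f y * Lam1 (fun y => sqgOp i g y) y) k) =
        fun k => lamSymbol (-1) k * (A i k - B i k) := funext fun k => congrArg _ (hH i k)
    rw [e, fCoeff_trigSeries
      (summable_norm_mul_of_le_one norm_lamSymbol_neg_one_le_one (hAB i))]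
  have hsum : ∀ i, Summable fun n =>
      ‖rieszSymbol i n * (lamSymbol (-1) n * (A i n - B i n))‖ := fun i =>
    summable_norm_mul_of_le_one (norm_rieszSymbol_le_one i)
      (summable_norm_mul_of_le_one norm_lamSymbol_neg_one_le_one (hAB i))
  rw [Fin.sum_univ_two, riesz_eq, riesz_eq]
  simp only [hT]
  rw [← trigSeries_add (hsum 0) (hsum 1), Sbil, lapInv_eq]
  congr 1
  ext n
  rcases eq_or_ne n 0 with rfl | hn
  · simp [lapInvSymbol, rieszSymbol]
  have hV : ∀ i, ContDiff ℝ 1 fun y => sqgOp i (fun z => lapC f z) y * g y +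
      sqgOp i g y * lapC f y := fun i =>
    ((hq.sqg i).contDiff_trigSeries.mul (hg.of_le h1)).add
      ((hb.sqg i).contDiff_trigSeries.mul ((contDiff_lapC hf).of_le h1))
  have hVp : ∀ i, TorusFun fun y => sqgOp i (fun z => lapC f z) y * g y +
      sqgOp i g y * lapC f y := fun i =>
    ((torusFun_trigSeries _).mul hgp).add ((torusFun_trigSeries _).mul hfp.lapC)
  have hdiv := fCoeff_divC hV hVp n
  rw [hS, hS] at hdiv
  have hl : ∀ i, HasSum _ _ := fun i =>
    (hasSum_freqConv (hq.sqg i).summable hb.summable n).add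
      (hasSum_freqConv hq.summable (hb.sqg i).summable n)
  have hr : ∀ i, HasSum _ (A i n - B i n) := fun i =>
    (hasSum_freqConv ha.lam.lam.summable (hb.sqg i).summable n).sub
      (hasSum_freqConv ha.lam.summable (hb.sqg i).lam.summable n)
  have hl' := (((hl 0).mul_left (Complex.I * (n 0 : ℂ))).add
    ((hl 1).mul_left (Complex.I * (n 1 : ℂ)))).mul_left (lapInvSymbol n)
  have hr' := (((hr 0).mul_left (lamSymbol (-1) n)).mul_left (rieszSymbol 0 n)).add
    (((hr 1).mul_left (lamSymbol (-1) n)).mul_left (rieszSymbol 1 n))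
  refine (congrArg _ hdiv).trans (hl'.unique ?_)
  convert hr' using 1
  ext k
  simp only [fCoeff_lapC hf hfp]
  rcases eq_or_ne k 0 with rfl | hk
  · simp [hf0]
  obtain ⟨l, rfl⟩ : ∃ l, n = k + l := ⟨n - k, by abel⟩
  rw [add_sub_cancel_left]
  rcases eq_or_ne l 0 with rfl | hl0
  · simp [hg0]
  linear_combination (fCoeff f k * fCoeff g l) * bilinear_symbol_identity hk hl0 hn

lemma contDiff_cplx {d : ℕ} {f : Vd d → ℝ} {n : WithTop ℕ∞} (hf : ContDiff ℝ n f) :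
    ContDiff ℝ n (cplx f) :=
  Complex.ofRealCLM.contDiff.comp hf

lemma TorusFun.cplx {d : ℕ} {f : Vd d → ℝ} (hf : TorusFun f) : TorusFun (cplx f) := fun x m =>
  congrArg Complex.ofReal (hf x m)

lemma MeanZeroR.fCoeff_cplx_zero {d : ℕ} {f : Vd d → ℝ} (hf : MeanZeroR f) :
    fCoeff (cplx f) 0 = 0 := by
  have h : ∫ x in box d, cplx f x = 0 := by
    simp only [cplx]
    rw [integral_complex_ofReal, show ∫ x in box d, f x = 0 from hf, Complex.ofReal_zero]
  simp [fCoeff_eq, torusChar_zero, h]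

/-- The identity `S[f,g] = Σ_i 𝓡_i T[Λf, (𝓡^⊥)_i g]`, where
`(𝓡^⊥₁,𝓡^⊥₂) = (-𝓡₂,𝓡₁)` are the components of `∇^⊥Λ^{-1}` (= `sqgOp`). -/
theorem bilinear_S_riesz_identity (f g : Vd 2 → ℝ)
    (hf : ContDiff ℝ (⊤ : ℕ∞) f) (hg : ContDiff ℝ (⊤ : ℕ∞) g)
    (hfp : TorusFun f) (hgp : TorusFun g)
    (hfm : MeanZeroR f) (hgm : MeanZeroR g) :
    ∀ x, Sbil (cplx f) (cplx g) x =
      ∑ i, Riesz i (Tbil (Lam1 (cplx f)) (fun y => sqgOp i (cplx g) y)) x := by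
  exact bilinear_identity_of_contDiff (contDiff_cplx hf) (contDiff_cplx hg) hfp.cplx hgp.cplx
    hfm.fCoeff_cplx_zero hgm.fCoeff_cplx_zero
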